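/- If Y is an m-connected CW-complex and Z is an n-connected CW-complex, then the join Y ∗ Z is (m+n+2)-connected. -/

import Mathlib

/-- `IsConnGE W n` says that `W` is `(n−1)`-connected, via the standard
characterization: for every `k ≤ n`, every continuous map `S^{k−1} → W` extends to a
continuous map `B^k → W` (for `k = 0` this says that `W` is nonempty). -/
def IsConnGE (W : Type*) [TopologicalSpace W] (n : ℕ) : Prop :=
  ∀ k : ℕ, k ≤ n →
    ∀ f : C(↥(Metric.sphere (0 : EuclideanSpace ℝ (Fin k)) 1), W),
      ∃ g : C(↥(Metric.closedBall (0 : EuclideanSpace ℝ (Fin k)) 1), W),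
        ∀ (x : EuclideanSpace ℝ (Fin k)) (hx : x ∈ Metric.sphere (0 : EuclideanSpace ℝ (Fin k)) 1),
          g ⟨x, Metric.sphere_subset_closedBall hx⟩ = f ⟨x, hx⟩

/-- The join relation on `Y × Z × [0,1]`: collapse the `Z`-coordinate at `0` and the
`Y`-coordinate at `1`. The topological join `Y ∗ Z` is the quotient `Quot (JoinRel Y Z)`
with the quotient topology. -/
def JoinRel (Y Z : Type*) : Y × Z × unitInterval → Y × Z × unitInterval → Prop :=
  fun a b =>
    (a.2.2 = 0 ∧ b.2.2 = 0 ∧ a.1 = b.1) ∨ (a.2.2 = 1 ∧ b.2.2 = 1 ∧ a.2.1 = b.2.1)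

namespace JoinConnectivity

open Set Metric Topology Function

section CubeExtension

/-- Continuous maps from the boundary of the cube `[-1, 1]^ι` to `W` extend to the whole cube. -/
def CubeExtends (W : Type*) [TopologicalSpace W] (ι : Type*) [Fintype ι] : Prop :=
  ∀ f : (ι → ℝ) → W, ContinuousOn f (sphere 0 1) →
    ∃ g : (ι → ℝ) → W, ContinuousOn g (closedBall 0 1) ∧ EqOn g f (sphere 0 1)

theorem exists_homeomorph_cube_ball {ι : Type*} [Fintype ι] {k : ℕ} (hk : Fintype.card ι = k) :
    ∃ h : (ι → ℝ) ≃ₜ EuclideanSpace ℝ (Fin k),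
      (∀ x, h x ∈ closedBall 0 1 ↔ x ∈ closedBall 0 1) ∧
      (∀ x, h x ∈ sphere 0 1 ↔ x ∈ sphere 0 1) := by
  let e : EuclideanSpace ℝ (Fin k) ≃L[ℝ] (ι → ℝ) :=
    (EuclideanSpace.equiv (Fin k) ℝ).trans
      (ContinuousLinearEquiv.piCongrLeft ℝ (fun _ => ℝ) (Fintype.equivFinOfCardEq hk).symm)
  let s : Set (EuclideanSpace ℝ (Fin k)) := e.toHomeomorph ⁻¹' closedBall 0 1
  have hconv : Convex ℝ s :=
    (convex_closedBall (0 : ι → ℝ) 1).linear_preimage e.toLinearEquiv.toLinearMap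
  have hclosed : IsClosed s := isClosed_closedBall.preimage e.continuous
  have hnonempty : (interior s).Nonempty := by
    rw [← Homeomorph.preimage_interior]
    refine ⟨0, ?_⟩
    have : e.toHomeomorph (0 : EuclideanSpace ℝ (Fin k)) = 0 := e.map_zero
    rw [mem_preimage, this]
    exact ball_subset_interior_closedBall (mem_ball_self one_pos)
  have hbdd : Bornology.IsBounded s :=
    (e.toHomeomorph.isCompact_preimage.2 (isCompact_closedBall _ _)).isBounded
  obtain ⟨h, -, hc, hf⟩ := exists_homeomorph_image_interior_closure_frontier_eq_unitBall
    hconv hnonempty hbdd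
  rw [hclosed.closure_eq] at hc
  rw [← Homeomorph.preimage_frontier, frontier_closedBall _ one_ne_zero] at hf
  refine ⟨e.toHomeomorph.symm.trans h, fun x => ?_, fun x => ?_⟩
  · rw [← hc, Homeomorph.trans_apply, h.injective.mem_set_image]
    simp [s]
  · rw [← hf, Homeomorph.trans_apply, h.injective.mem_set_image, mem_preimage,
      Homeomorph.apply_symm_apply]

theorem IsConnGE.nonempty {W : Type*} [TopologicalSpace W] {n : ℕ} (hW : IsConnGE W n) :
    Nonempty W := by
  have : IsEmpty (sphere (0 : EuclideanSpace ℝ (Fin 0)) 1) :=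
    ⟨fun x => by simpa [Subsingleton.elim x.1 0] using x.2⟩
  obtain ⟨g, -⟩ := hW 0 n.zero_le ⟨isEmptyElim, continuous_of_const fun x => isEmptyElim x⟩
  exact ⟨g ⟨0, mem_closedBall_self zero_le_one⟩⟩

theorem IsConnGE.cubeExtends {W : Type*} [TopologicalSpace W] {n : ℕ} (hW : IsConnGE W n)
    {ι : Type*} [Fintype ι] (hι : Fintype.card ι ≤ n) : CubeExtends W ι := by
  classical
  obtain ⟨w⟩ := IsConnGE.nonempty hW
  obtain ⟨h, hb, hs⟩ := exists_homeomorph_cube_ball (ι := ι) rfl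
  intro f hf
  obtain ⟨g, hg⟩ := hW _ hι ⟨fun x => f (h.symm x),
    hf.comp_continuous (h.symm.continuous.comp continuous_subtype_val) fun x => by
      rw [← hs, h.apply_symm_apply]; exact x.2⟩
  refine ⟨fun x => if hx : h x ∈ closedBall 0 1 then g ⟨h x, hx⟩ else w, ?_, fun x hx => ?_⟩
  · rw [continuousOn_iff_continuous_domRestrict]
    have : (closedBall (0 : ι → ℝ) 1).domRestrict
        (fun x => if hx : h x ∈ closedBall 0 1 then g ⟨h x, hx⟩ else w) =
        fun x : closedBall (0 : ι → ℝ) 1 => g ⟨h x, (hb x).2 x.2⟩ := by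
      funext x
      have hx : h x ∈ closedBall 0 1 := (hb x).2 x.2
      rw [domRestrict_apply, dif_pos hx]
    rw [this]
    exact g.continuous.comp ((h.continuous.comp continuous_subtype_val).subtype_mk _)
  · have hx' := (hs x).2 hx
    simp only [dif_pos (sphere_subset_closedBall hx')]
    rw [hg _ hx']
    simp

theorem isConnGE_of_cubeExtends {W : Type*} [TopologicalSpace W] [Nonempty W] {n : ℕ}
    (hW : ∀ k ≤ n, CubeExtends W (Fin k)) : IsConnGE W n := by
  classical
  intro k hk f
  obtain ⟨w⟩ := ‹Nonempty W›
  obtain ⟨h, hb, hs⟩ := exists_homeomorph_cube_ball (Fintype.card_fin k)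
  obtain ⟨g, hg, hgf⟩ := hW k hk (fun x => if hx : h x ∈ sphere 0 1 then f ⟨h x, hx⟩ else w) (by
    rw [continuousOn_iff_continuous_domRestrict]
    have : (sphere (0 : Fin k → ℝ) 1).domRestrict
        (fun x => if hx : h x ∈ sphere 0 1 then f ⟨h x, hx⟩ else w) =
        fun x : sphere (0 : Fin k → ℝ) 1 => f ⟨h x, (hs x).2 x.2⟩ := by
      funext x
      have hx : h x ∈ sphere 0 1 := (hs x).2 x.2
      rw [domRestrict_apply, dif_pos hx]
    rw [this]
    exact f.continuous.comp ((h.continuous.comp continuous_subtype_val).subtype_mk _))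
  refine ⟨⟨fun x => g (h.symm x),
    hg.comp_continuous (h.symm.continuous.comp continuous_subtype_val) fun x => by
      rw [← hb, h.apply_symm_apply]; exact x.2⟩, fun x hx => ?_⟩
  have hx' : h (h.symm x) ∈ sphere 0 1 := by rwa [h.apply_symm_apply]
  have := hgf ((hs _).1 hx')
  simp only [dif_pos hx'] at this
  simpa using this

end CubeExtension

section Join

variable {Y Z : Type*}

/-- The join coordinate of a point of the join. -/
def param : Quot (JoinRel Y Z) → ℝ :=
  Quot.lift (fun a => (a.2.2 : ℝ)) (by
    rintro a b (⟨h, h', -⟩ | ⟨h, h', -⟩) <;> rw [h, h'])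

/-- The `Y`-coordinate of a point of the join, with a default value where it is undefined. -/
noncomputable def fstPt (y₀ : Y) : Quot (JoinRel Y Z) → Y :=
  Quot.lift (fun a => if (a.2.2 : ℝ) < 1 then a.1 else y₀) (by
    rintro a b (⟨h, h', h''⟩ | ⟨h, h', -⟩) <;> simp [*])

/-- The `Z`-coordinate of a point of the join, with a default value where it is undefined. -/
noncomputable def sndPt (z₀ : Z) : Quot (JoinRel Y Z) → Z :=
  Quot.lift (fun a => if 0 < (a.2.2 : ℝ) then a.2.1 else z₀) (by
    rintro a b (⟨h, h', -⟩ | ⟨h, h', h''⟩) <;> simp [*])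

theorem param_mem_Icc (q : Quot (JoinRel Y Z)) : param q ∈ Icc (0 : ℝ) 1 := by
  induction q using Quot.ind with
  | mk a => exact a.2.2.2

theorem mk_eq_of_eq_zero {y : Y} {z z' : Z} {t : unitInterval} (ht : t = 0) :
    Quot.mk (JoinRel Y Z) (y, z, t) = Quot.mk (JoinRel Y Z) (y, z', t) :=
  Quot.sound (Or.inl ⟨ht, ht, rfl⟩)

theorem mk_eq_of_eq_one {y y' : Y} {z : Z} {t : unitInterval} (ht : t = 1) :
    Quot.mk (JoinRel Y Z) (y, z, t) = Quot.mk (JoinRel Y Z) (y', z, t) :=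
  Quot.sound (Or.inr ⟨ht, ht, rfl⟩)

/-- Affine stretching of the unit interval about its midpoint, clamped to the unit interval. -/
noncomputable def stretch (s t : ℝ) : unitInterval :=
  projIcc 0 1 zero_le_one (t + s * (2 * t - 1))

theorem continuous_stretch : Continuous fun p : ℝ × ℝ => stretch p.1 p.2 :=
  continuous_projIcc.comp (by fun_prop)

theorem stretch_eq_zero {s t : ℝ} (h : t + s * (2 * t - 1) ≤ 0) : stretch s t = 0 :=
  projIcc_of_le_left _ h

theorem stretch_eq_one {s t : ℝ} (h : 1 ≤ t + s * (2 * t - 1)) : stretch s t = 1 :=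
  projIcc_of_right_le _ h

theorem stretch_zero (t : unitInterval) : stretch 0 t = t := by
  simp [stretch]

/-- The self-map of the join which stretches the join coordinate. -/
noncomputable def stretchMap (q : Quot (JoinRel Y Z)) (s : unitInterval) : Quot (JoinRel Y Z) :=
  Quot.lift (fun a => Quot.mk (JoinRel Y Z) (a.1, a.2.1, stretch s a.2.2)) (by
    rintro ⟨y, z, t⟩ ⟨y', z', t'⟩ (⟨h, h', h''⟩ | ⟨h, h', h''⟩) <;> simp only at h h' h'' <;>
      subst h h' h''
    · exact mk_eq_of_eq_zero (stretch_eq_zero (by simpa using s.2.1))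
    · exact mk_eq_of_eq_one (stretch_eq_one (by norm_num; exact s.2.1))) q

theorem stretchMap_zero (q : Quot (JoinRel Y Z)) : stretchMap q 0 = q := by
  induction q using Quot.ind with
  | mk a => simp [stretchMap, stretch_zero]

theorem stretchMap_one_eq_mk {q : Quot (JoinRel Y Z)} {y₀ y : Y} {z₀ z : Z}
    (hy : param q < 3 / 4 → y = fstPt y₀ q) (hz : 1 / 4 < param q → z = sndPt z₀ q) :
    stretchMap q 1 = Quot.mk (JoinRel Y Z) (y, z, stretch 1 (param q)) := by
  induction q using Quot.ind with
  | mk a =>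
    obtain ⟨y', z', t⟩ := a
    simp only [param, fstPt, sndPt] at hy hz
    simp only [stretchMap, param, Icc.coe_one]
    by_cases h1 : (t : ℝ) < 3 / 4
    · rw [if_pos (by linarith)] at hy
      rw [hy h1]
      by_cases h2 : 1 / 4 < (t : ℝ)
      · rw [if_pos (by linarith)] at hz
        rw [hz h2]
      · exact mk_eq_of_eq_zero (stretch_eq_zero (by linarith))
    · rw [if_pos (by linarith)] at hz
      rw [hz (by linarith)]
      exact mk_eq_of_eq_one (stretch_eq_one (by linarith))

variable [TopologicalSpace Y] [TopologicalSpace Z]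

theorem continuous_param : Continuous (param : Quot (JoinRel Y Z) → ℝ) :=
  isQuotientMap_quot_mk.continuous_iff.2 (by unfold param comp; fun_prop)

theorem continuousOn_fstPt (y₀ : Y) :
    ContinuousOn (fstPt y₀ : Quot (JoinRel Y Z) → Y) {q | param q < 1} := by
  rw [continuousOn_open_iff (isOpen_lt continuous_param continuous_const)]
  intro U hU
  rw [← isQuotientMap_quot_mk.isOpen_preimage]
  have : (Quot.mk (JoinRel Y Z)) ⁻¹' ({q | param q < 1} ∩ fstPt y₀ ⁻¹' U) =
      {a | (a.2.2 : ℝ) < 1} ∩ {a | a.1 ∈ U} := by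
    ext a
    simp only [mem_preimage, mem_inter_iff, mem_ofPred_eq, param, fstPt]
    exact and_congr_right fun h => by rw [if_pos h]
  rw [this]
  exact (isOpen_lt (by fun_prop) (by fun_prop)).inter (hU.preimage continuous_fst)

theorem continuousOn_sndPt (z₀ : Z) :
    ContinuousOn (sndPt z₀ : Quot (JoinRel Y Z) → Z) {q | 0 < param q} := by
  rw [continuousOn_open_iff (isOpen_lt continuous_const continuous_param)]
  intro U hU
  rw [← isQuotientMap_quot_mk.isOpen_preimage]
  have : (Quot.mk (JoinRel Y Z)) ⁻¹' ({q | 0 < param q} ∩ sndPt z₀ ⁻¹' U) =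
      {a | 0 < (a.2.2 : ℝ)} ∩ {a | a.2.1 ∈ U} := by
    ext a
    simp only [mem_preimage, mem_inter_iff, mem_ofPred_eq, param, sndPt]
    exact and_congr_right fun h => by rw [if_pos h]
  rw [this]
  exact (isOpen_lt (by fun_prop) (by fun_prop)).inter (hU.preimage (by fun_prop))

theorem continuous_stretchMap :
    Continuous fun p : Quot (JoinRel Y Z) × unitInterval => stretchMap p.1 p.2 := by
  refine isQuotientMap_quot_mk.continuous_lift_prod_left
    (f := Quot.mk (JoinRel Y Z)) (Y := unitInterval) ?_
  refine continuous_quot_mk.comp (f := fun p : (Y × Z × unitInterval) × unitInterval =>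
    (p.1.1, p.1.2.1, stretch p.2 p.1.2.2)) ?_
  have := continuous_stretch.comp (f := fun p : (Y × Z × unitInterval) × unitInterval =>
    ((p.2 : ℝ), (p.1.2.2 : ℝ))) (by fun_prop)
  exact (by fun_prop : Continuous _).prodMk ((by fun_prop : Continuous _).prodMk this)

theorem continuousOn_mk_stretch {X : Type*} [TopologicalSpace X] {B : Set X} {T : X → ℝ}
    (hT : ContinuousOn T B) {y : X → Y} {z : X → Z} (hy : ContinuousOn y (B ∩ {x | T x < 3 / 4}))
    (hz : ContinuousOn z (B ∩ {x | 1 / 4 < T x})) :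
    ContinuousOn (fun x => Quot.mk (JoinRel Y Z) (y x, z x, stretch 1 (T x))) B := by
  intro x hx
  have hlt {c : ℝ} (h : T x < c) : ∀ᶠ x' in 𝓝[B] x, T x' < c := (hT x hx).eventually_lt_const h
  have hgt {c : ℝ} (h : c < T x) : ∀ᶠ x' in 𝓝[B] x, c < T x' := (hT x hx).eventually_const_lt h
  have hy' (h : T x < 3 / 4) : ContinuousWithinAt y B x :=
    (hy x ⟨hx, h⟩).mono_of_mem_nhdsWithin (Filter.inter_mem self_mem_nhdsWithin (hlt h))
  have hz' (h : 1 / 4 < T x) : ContinuousWithinAt z B x :=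
    (hz x ⟨hx, h⟩).mono_of_mem_nhdsWithin (Filter.inter_mem self_mem_nhdsWithin (hgt h))
  have hs : ContinuousWithinAt (fun x => stretch 1 (T x)) B x :=
    (continuous_stretch.comp (continuous_const.prodMk continuous_id)).continuousAt
      |>.comp_continuousWithinAt (hT x hx)
  have hmk {y' : X → Y} {z' : X → Z} (h1 : ContinuousWithinAt y' B x)
      (h2 : ContinuousWithinAt z' B x) :
      ContinuousWithinAt (fun x => Quot.mk (JoinRel Y Z) (y' x, z' x, stretch 1 (T x))) B x :=
    continuous_quot_mk.continuousAt.comp_continuousWithinAt (h1.prodMk (h2.prodMk hs))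
  by_cases h1 : T x < 1 / 3
  · refine (hmk (hy' (by linarith)) (continuousWithinAt_const (b := z x))).congr_of_eventuallyEq
      ?_ rfl
    filter_upwards [hlt h1] with x' hx'
    exact mk_eq_of_eq_zero (stretch_eq_zero (by linarith))
  by_cases h2 : 2 / 3 < T x
  · refine (hmk (continuousWithinAt_const (b := y x)) (hz' (by linarith))).congr_of_eventuallyEq
      ?_ rfl
    filter_upwards [hgt h2] with x' hx'
    exact mk_eq_of_eq_one (stretch_eq_one (by linarith))
  exact hmk (hy' (by linarith)) (hz' (by linarith))

end Join

section Grid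

variable {ι : Type*}

/-- The closed face of the integer grid with lower corner `a` and free coordinates `J`. -/
def face [DecidableEq ι] (a : ι → ℤ) (J : Finset ι) : Set (ι → ℝ) :=
  Icc (fun i => (a i : ℝ)) (fun i => a i + if i ∈ J then 1 else 0)

theorem isClosed_face [DecidableEq ι] (a : ι → ℤ) (J : Finset ι) : IsClosed (face a J) := isClosed_Icc

theorem eq_of_mem_face [DecidableEq ι] {a : ι → ℤ} {J : Finset ι} {x : ι → ℝ} (hx : x ∈ face a J) {i : ι}
    (hi : i ∉ J) : x i = a i :=
  le_antisymm (by simpa [hi] using hx.2 i) (hx.1 i)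

variable [Fintype ι]

open Classical in
/-- The coordinates of `x` which are not integers. -/
noncomputable def nonInt (x : ι → ℝ) : Finset ι :=
  {i | x i ≠ ⌊x i⌋}

/-- The union of the faces of the integer grid of dimension less than `j`. -/
def skel (ι : Type*) [Fintype ι] (j : ℕ) : Set (ι → ℝ) :=
  {x | (nonInt x).card < j}

theorem mem_nonInt {x : ι → ℝ} {i : ι} : i ∈ nonInt x ↔ x i ≠ ⌊x i⌋ := by
  simp [nonInt]

theorem notMem_nonInt_of_eq {x : ι → ℝ} {i : ι} {n : ℤ} (h : x i = n) : i ∉ nonInt x := by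
  simp [mem_nonInt, h]

variable [DecidableEq ι]

theorem mem_face_floor (x : ι → ℝ) : x ∈ face (fun i => ⌊x i⌋) (nonInt x) := by
  refine ⟨fun i => Int.floor_le _, fun i => ?_⟩
  by_cases h : i ∈ nonInt x
  · simpa [h] using (Int.lt_floor_add_one (x i)).le
  · have := mem_nonInt.not_left.1 h
    simp only [h, if_false, add_zero]
    exact this.le

theorem nonInt_subset_of_mem_face {a : ι → ℤ} {J : Finset ι} {x : ι → ℝ} (hx : x ∈ face a J) :
    nonInt x ⊆ J := by
  intro i hi
  by_contra h
  exact notMem_nonInt_of_eq (eq_of_mem_face hx h) hi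

theorem floor_eq_of_mem_face {a : ι → ℤ} {J : Finset ι} {x : ι → ℝ} (hx : x ∈ face a J) {i : ι}
    (hi : i ∈ nonInt x ∨ i ∉ J) : ⌊x i⌋ = a i := by
  by_cases hJ : i ∈ J
  · have hi := hi.resolve_right (not_not.2 hJ)
    have h1 := hx.1 i
    have h2 := hx.2 i
    simp only [hJ, if_true] at h1 h2
    refine Int.floor_eq_iff.2 ⟨h1, lt_of_le_of_ne h2 fun h => ?_⟩
    exact notMem_nonInt_of_eq (n := a i + 1) (by push_cast; exact h) hi
  · rw [eq_of_mem_face hx hJ, Int.floor_intCast]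

theorem face_floor_subset {a : ι → ℤ} {J : Finset ι} {x : ι → ℝ} (hx : x ∈ face a J) :
    face (fun i => ⌊x i⌋) (nonInt x) ⊆ face a J := by
  intro y hy
  refine ⟨fun i => ?_, fun i => ?_⟩ <;> by_cases hi : i ∈ nonInt x
  · have := hy.1 i
    simpa only [floor_eq_of_mem_face hx (Or.inl hi)] using this
  · rw [eq_of_mem_face hy hi, ← mem_nonInt.not_left.1 hi]
    exact hx.1 i
  · have := hy.2 i
    simp only [hi, if_true, floor_eq_of_mem_face hx (Or.inl hi)] at this
    simpa [nonInt_subset_of_mem_face hx hi] using this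
  · rw [eq_of_mem_face hy hi, ← mem_nonInt.not_left.1 hi]
    exact hx.2 i

theorem locallyFinite_face :
    LocallyFinite fun p : (ι → ℤ) × Finset ι => face p.1 p.2 := by
  intro x
  refine ⟨ball x 1, ball_mem_nhds x one_pos,
    ((finite_Icc (fun i => ⌊x i⌋ - 2) (fun i => ⌊x i⌋ + 2)).prod finite_univ).subset ?_⟩
  rintro ⟨a, J⟩ ⟨y, hy, hyx⟩
  have key (i : ι) : ⌊x i⌋ - 2 ≤ a i ∧ a i ≤ ⌊x i⌋ + 2 := by
    have h1 := hy.1 i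
    have h2 : y i ≤ a i + 1 := (hy.2 i).trans (by dsimp only; split_ifs <;> linarith)
    have h3 := (dist_le_pi_dist y x i).trans_lt hyx
    rw [Real.dist_eq, abs_lt] at h3
    dsimp only at h1
    have h4 := Int.floor_le (x i)
    have h5 := Int.lt_floor_add_one (x i)
    constructor
    · have : ((⌊x i⌋ - 2 : ℤ) : ℝ) ≤ a i := by push_cast; linarith
      exact_mod_cast this
    · have : (a i : ℝ) ≤ ((⌊x i⌋ + 2 : ℤ) : ℝ) := by push_cast; linarith
      exact_mod_cast this
  exact ⟨⟨fun i => (key i).1, fun i => (key i).2⟩, mem_univ _⟩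

theorem isClosed_skel (j : ℕ) : IsClosed (skel ι j) := by
  have : skel ι j = ⋃ p : {p : (ι → ℤ) × Finset ι // p.2.card < j}, face p.1.1 p.1.2 := by
    ext x
    simp only [mem_iUnion]
    refine ⟨fun hx => ⟨⟨(_, _), hx⟩, mem_face_floor x⟩, ?_⟩
    rintro ⟨p, hx⟩
    exact (Finset.card_le_card (nonInt_subset_of_mem_face hx)).trans_lt p.2
  rw [this]
  exact (locallyFinite_face.comp_injective Subtype.val_injective).isClosed_iUnion
    fun p => isClosed_face _ _

theorem mem_sphere_pi {κ : Type*} [Fintype κ] {u : κ → ℝ} (hu : u ∈ sphere (0 : κ → ℝ) 1) :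
    (∀ i, |u i| ≤ 1) ∧ ∃ i, |u i| = 1 := by
  rw [mem_sphere_zero_iff_norm] at hu
  have h1 (i : κ) : |u i| ≤ 1 := hu ▸ norm_le_pi_norm u i
  refine ⟨h1, ?_⟩
  by_contra! h
  exact ((pi_norm_lt_iff one_pos).2 fun i => lt_of_le_of_ne (h1 i) (h i)).ne hu

theorem mem_sphere_pi_of_abs_eq {κ : Type*} [Fintype κ] {u : κ → ℝ}
    (hu : u ∈ closedBall (0 : κ → ℝ) 1) {i : κ} (hi : |u i| = 1) : u ∈ sphere (0 : κ → ℝ) 1 := by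
  rw [mem_closedBall_zero_iff] at hu
  rw [mem_sphere_zero_iff_norm]
  exact le_antisymm hu (hi ▸ norm_le_pi_norm u i)

/-- A map on the boundary of a face extends to the face. -/
theorem exists_extend_face {W : Type*} [TopologicalSpace W] {f : (ι → ℝ) → W} {j : ℕ}
    (hf : ContinuousOn f (skel ι j)) (a : ι → ℤ) {J : Finset ι} (hJ : J.card = j)
    (hW : CubeExtends W J) :
    ∃ g : (ι → ℝ) → W, ContinuousOn g (face a J) ∧ EqOn g f (face a J ∩ skel ι j) := by
  let φ : (J → ℝ) → ι → ℝ := fun u i => a i + if h : i ∈ J then (1 + u ⟨i, h⟩) / 2 else 0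
  let ψ : (ι → ℝ) → J → ℝ := fun x i => 2 * (x i - a i) - 1
  have hφ : Continuous φ := by
    refine continuous_pi fun i => ?_
    by_cases h : i ∈ J
    · simp only [φ, h, dif_pos]; fun_prop
    · simp only [φ, h, dif_neg, not_false_iff]; fun_prop
  have hψ : Continuous ψ := by fun_prop
  have hφψ {x : ι → ℝ} (hx : x ∈ face a J) : φ (ψ x) = x := by
    funext i
    by_cases h : i ∈ J
    · simp only [φ, ψ, h, dif_pos]; ring
    · simp [φ, h, eq_of_mem_face hx h]
  have hψm : MapsTo ψ (face a J) (closedBall 0 1) := by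
    intro x hx
    rw [mem_closedBall_zero_iff, pi_norm_le_iff_of_nonneg zero_le_one]
    intro i
    have h1 := hx.1 i
    have h2 := hx.2 i
    simp only [i.2, if_true] at h1 h2
    rw [Real.norm_eq_abs, abs_le]
    constructor <;> simp only [ψ] <;> linarith
  have hφm : MapsTo φ (sphere 0 1) (skel ι j) := by
    intro u hu
    obtain ⟨-, i, hi⟩ := mem_sphere_pi hu
    rw [skel, mem_ofPred_eq, ← hJ]
    refine Finset.card_lt_card ⟨fun i' hi' => ?_, fun h => ?_⟩
    · by_contra h
      exact notMem_nonInt_of_eq (n := a i') (by simp [φ, h]) hi'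
    · refine mem_nonInt.1 (h i.2) ?_
      rcases eq_or_eq_neg_of_abs_eq hi with h | h <;> simp [φ, h]
  obtain ⟨g, hg, hgf⟩ := hW (f ∘ φ) (hf.comp hφ.continuousOn hφm)
  refine ⟨g ∘ ψ, hg.comp hψ.continuousOn hψm, fun x hx => ?_⟩
  have : ψ x ∈ sphere 0 1 := by
    have hlt : (nonInt x).card < J.card := hJ ▸ hx.2
    obtain ⟨i, hi, hi'⟩ := Finset.exists_mem_notMem_of_card_lt_card hlt
    have h1 := hx.1.1 i
    have h2 := hx.1.2 i
    have h3 := mem_nonInt.not_left.1 hi'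
    simp only [hi, if_true] at h1 h2
    refine mem_sphere_pi_of_abs_eq (hψm hx.1) (i := ⟨i, hi⟩) ?_
    rw [h3] at h1 h2
    have h1' : a i ≤ ⌊x i⌋ := by exact_mod_cast h1
    have h2' : ⌊x i⌋ ≤ a i + 1 := by exact_mod_cast h2
    simp only [ψ]
    rcases (by omega : ⌊x i⌋ = a i ∨ ⌊x i⌋ = a i + 1) with h | h
    · rw [h3, h]; norm_num
    · rw [h3, h]; push_cast; rw [add_sub_cancel_left]; norm_num
  rw [comp_apply, hgf this, comp_apply, hφψ hx.1]

theorem exists_extend_skel_succ {W : Type*} [TopologicalSpace W] {K : Set (ι → ℝ)}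
    (hKc : IsClosed K) (hK : ∀ x ∈ K, face (fun i => ⌊x i⌋) (nonInt x) ⊆ K) {j : ℕ}
    (hW : ∀ J : Finset ι, J.card = j → CubeExtends W J) {f : (ι → ℝ) → W}
    (hf : ContinuousOn f (K ∪ skel ι j)) :
    ∃ g : (ι → ℝ) → W, ContinuousOn g (K ∪ skel ι (j + 1)) ∧ EqOn g f (K ∪ skel ι j) := by
  classical
  have hex (a : ι → ℤ) (J : Finset ι) : ∃ g : (ι → ℝ) → W, J.card = j →
      ContinuousOn g (face a J) ∧ EqOn g f (face a J ∩ skel ι j) := by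
    by_cases hJ : J.card = j
    · obtain ⟨g, hg⟩ := exists_extend_face (hf.mono subset_union_right) a hJ (hW J hJ)
      exact ⟨g, fun _ => hg⟩
    · exact ⟨f, fun h => absurd h hJ⟩
  choose e he using hex
  let g : (ι → ℝ) → W := fun x =>
    if x ∈ K ∪ skel ι j then f x else e (fun i => ⌊x i⌋) (nonInt x) x
  have hgf : EqOn g f (K ∪ skel ι j) := fun x hx => if_pos hx
  refine ⟨g, ?_, hgf⟩
  let I := {p : (ι → ℤ) × Finset ι // p.2.card = j ∧ ¬ face p.1 p.2 ⊆ K}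
  have hge (p : I) : EqOn g (e p.1.1 p.1.2) (face p.1.1 p.1.2) := by
    intro x hx
    by_cases hxs : x ∈ skel ι j
    · rw [hgf (Or.inr hxs), (he _ _ p.2.1).2 ⟨hx, hxs⟩]
    · have hJ : nonInt x = p.1.2 :=
        Finset.eq_of_subset_of_card_le (nonInt_subset_of_mem_face hx)
          (p.2.1.le.trans (not_lt.1 hxs))
      have ha : (fun i => ⌊x i⌋) = p.1.1 :=
        funext fun i => floor_eq_of_mem_face hx (by rw [hJ]; exact em _)
      have hxK : x ∉ K := fun h => p.2.2 (by simpa only [hJ, ha] using hK x h)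
      have : x ∉ K ∪ skel ι j := by simp [hxK, hxs]
      simp only [g, if_neg this, hJ, ha]
  have hlf : LocallyFinite fun p : I => face p.1.1 p.1.2 :=
    locallyFinite_face.comp_injective Subtype.val_injective
  have hcl (p : I) : IsClosed (face p.1.1 p.1.2) := isClosed_face _ _
  refine ((hf.congr hgf).union_of_isClosed
    (hlf.continuousOn_iUnion hcl fun p => (he _ _ p.2.1).1.congr (hge p))
    (hKc.union (isClosed_skel j)) (hlf.isClosed_iUnion hcl)).mono ?_
  rintro x (hx | hx)
  · exact Or.inl (Or.inl hx)
  · by_cases hx' : x ∈ K ∪ skel ι j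
    · exact Or.inl hx'
    · rw [mem_union, not_or] at hx'
      refine Or.inr (mem_iUnion.2 ⟨⟨(fun i => ⌊x i⌋, nonInt x), ?_, fun h => hx'.1 ?_⟩, ?_⟩)
      · exact le_antisymm (Nat.lt_succ_iff.1 hx) (not_lt.1 hx'.2)
      · exact h (mem_face_floor x)
      · exact mem_face_floor x

/-- The union of the top-dimensional grid cubes contained in `D`. -/
def core (D : Set (ι → ℝ)) : Set (ι → ℝ) :=
  ⋃ a : {a : ι → ℤ // face a Finset.univ ⊆ D}, face a.1 Finset.univ

theorem core_subset (D : Set (ι → ℝ)) : core D ⊆ D := iUnion_subset fun a => a.2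

theorem isClosed_core (D : Set (ι → ℝ)) : IsClosed (core D) := by
  have hinj : Injective fun a : {a : ι → ℤ // face a Finset.univ ⊆ D} =>
      (a.1, (Finset.univ : Finset ι)) :=
    fun a b h => Subtype.ext (Prod.ext_iff.1 h).1
  exact (locallyFinite_face.comp_injective hinj).isClosed_iUnion fun a => isClosed_face _ _

theorem exists_extend_skel {W : Type*} [TopologicalSpace W] {p : ℕ}
    (hW : ∀ J : Finset ι, J.card ≤ p → CubeExtends W J) {D : Set (ι → ℝ)} {f : (ι → ℝ) → W}
    (hf : ContinuousOn f D) :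
    ∃ g : (ι → ℝ) → W, ContinuousOn g (core D ∪ skel ι (p + 1)) ∧ EqOn g f (core D) := by
  suffices ∀ j ≤ p + 1, ∃ g : (ι → ℝ) → W,
      ContinuousOn g (core D ∪ skel ι j) ∧ EqOn g f (core D) from this _ le_rfl
  intro j
  induction j with
  | zero =>
    refine fun _ => ⟨f, hf.mono (union_subset (core_subset D) fun x hx => ?_), fun _ _ => rfl⟩
    exact absurd hx (Nat.not_lt_zero _)
  | succ j ih =>
    intro hj
    obtain ⟨g, hg, hgf⟩ := ih (by omega)
    obtain ⟨g', hg', hgf'⟩ := exists_extend_skel_succ (isClosed_core D) (fun x hx => by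
      obtain ⟨a, ha⟩ := mem_iUnion.1 hx
      exact (face_floor_subset ha).trans (subset_iUnion_of_subset a subset_rfl))
      (fun J hJ => hW J (by omega)) hg
    exact ⟨g', hg', fun x hx => (hgf' (Or.inl hx)).trans (hgf hx)⟩

end Grid

section Retraction

/-- Expansion of the unit interval about its midpoint by the factor `w`, clamped. -/
noncomputable def expand (w v : ℝ) : ℝ :=
  1 / 2 + max (-(1 / 2)) (min (1 / 2) (w * (v - 1 / 2)))

theorem expand_mem_Icc (w v : ℝ) : expand w v ∈ Icc (0 : ℝ) 1 := by
  have h1 : -(1 / 2) ≤ max (-(1 / 2)) (min (1 / 2) (w * (v - 1 / 2))) := le_max_left _ _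
  have h2 : max (-(1 / 2)) (min (1 / 2) (w * (v - 1 / 2))) ≤ 1 / 2 :=
    max_le (by norm_num) (min_le_left _ _)
  constructor <;> unfold expand <;> linarith

theorem expand_eq_zero {w v : ℝ} (h : w * (v - 1 / 2) ≤ -(1 / 2)) : expand w v = 0 := by
  rw [expand, max_eq_left ((min_le_right _ _).trans h)]; norm_num

theorem expand_eq_one {w v : ℝ} (h : 1 / 2 ≤ w * (v - 1 / 2)) : expand w v = 1 := by
  rw [expand, min_eq_left h]; norm_num

theorem expand_one {v : ℝ} (h : v ∈ Icc (0 : ℝ) 1) : expand 1 v = v := by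
  rw [expand, one_mul, min_eq_right (by linarith [h.2]), max_eq_right (by linarith [h.1])]; ring

/-- Expansion of each unit interval with integer end points about its midpoint. -/
noncomputable def expandCell (w u : ℝ) : ℝ :=
  ⌊u⌋ + expand w (Int.fract u)

theorem continuous_expandCell {X : Type*} [TopologicalSpace X] {w u : X → ℝ} (hw : Continuous w)
    (hw1 : ∀ x, 1 ≤ w x) (hu : Continuous u) : Continuous fun x => expandCell (w x) (u x) := by
  have h : Continuous fun x => expand (w x) (Int.fract (u x)) - Int.fract (u x) := by
    refine ContinuousOn.comp_fract (f := fun x v => expand (w x) v - v) ?_ hu fun x => ?_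
    · refine Continuous.continuousOn ?_
      unfold expand uncurry
      fun_prop
    · have := hw1 x
      rw [expand_eq_zero (by linarith), expand_eq_one (by linarith)]; norm_num
  refine (hu.add h).congr fun x => ?_
  rw [expandCell, ← Int.self_sub_fract]
  change u x + (expand (w x) (Int.fract (u x)) - Int.fract (u x)) = _
  ring

/-- A normalized distance to the nearest integer, with values in `[0, 1]`. -/
noncomputable def intDist (u : ℝ) : ℝ :=
  1 - |2 * Int.fract u - 1|

theorem continuous_intDist : Continuous intDist := by
  refine ContinuousOn.comp_fract'' (f := fun v : ℝ => 1 - |2 * v - 1|) ?_ (by norm_num)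
  exact Continuous.continuousOn (by fun_prop)

theorem intDist_mem_Icc (u : ℝ) : intDist u ∈ Icc (0 : ℝ) 1 := by
  have h1 := Int.fract_nonneg u
  have h2 := (Int.fract_lt_one u).le
  have h3 : |2 * Int.fract u - 1| ≤ 1 := abs_le.2 ⟨by linarith, by linarith⟩
  constructor <;> unfold intDist <;> linarith [abs_nonneg (2 * Int.fract u - 1)]

theorem intDist_add_half (u : ℝ) : intDist (u + 1 / 2) = 1 - intDist u := by
  have h1 := Int.fract_nonneg u
  have h2 := Int.fract_lt_one u
  unfold intDist
  by_cases h : Int.fract u < 1 / 2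
  · have : Int.fract (u + 1 / 2) = Int.fract u + 1 / 2 :=
      Int.fract_eq_iff.2 ⟨by linarith, by linarith, ⌊u⌋, by rw [← Int.self_sub_floor]; ring⟩
    rw [this, abs_of_nonneg (by linarith), abs_of_nonpos (by linarith)]; ring
  · have : Int.fract (u + 1 / 2) = Int.fract u - 1 / 2 :=
      Int.fract_eq_iff.2 ⟨by linarith, by linarith, ⌊u⌋ + 1, by
        rw [← Int.self_sub_floor]; push_cast; ring⟩
    rw [this, abs_of_nonpos (by linarith), abs_of_nonneg (by linarith)]; ring

theorem exists_expandCell_eq_int {a u : ℝ} (ha : a < 1) (hu : intDist u ≤ a) :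
    ∃ n : ℤ, expandCell (1 - a)⁻¹ u = n := by
  have ha' : 0 < 1 - a := by linarith
  have hc : (1 - a)⁻¹ * (1 - a) = 1 := inv_mul_cancel₀ ha'.ne'
  have hpos : 0 < (1 - a)⁻¹ := inv_pos.2 ha'
  have h : 1 - a ≤ |2 * Int.fract u - 1| := by unfold intDist at hu; linarith
  rcases le_abs.1 h with h | h
  · refine ⟨⌊u⌋ + 1, ?_⟩
    rw [expandCell, expand_eq_one (by nlinarith)]; push_cast; ring
  · refine ⟨⌊u⌋, ?_⟩
    rw [expandCell, expand_eq_zero (by nlinarith)]; ring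

variable {ι : Type*} [Fintype ι]

theorem exists_pushforward {W : Type*} [TopologicalSpace W] {p r : ℕ}
    (hr : Fintype.card ι = p + r) (hW : ∀ J : Finset ι, J.card ≤ p → CubeExtends W J)
    {D B : Set (ι → ℝ)} {f : (ι → ℝ) → W} (hf : ContinuousOn f D) {T l : (ι → ℝ) → ℝ}
    (hT : ContinuousOn T B) (hl : ContinuousOn l B) (hT01 : ∀ x ∈ B, T x ∈ Ico (0 : ℝ) 1)
    (hl01 : ∀ x ∈ B, l x ∈ Icc (0 : ℝ) 1)
    (hB : ∀ x ∈ B, closedBall x 1 ⊆ D ∨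
      l x = 1 ∧ r ≤ (Finset.univ.filter fun i => intDist (x i) ≤ T x).card) :
    ∃ g : (ι → ℝ) → W, ContinuousOn g B ∧
      ∀ x ∈ B, l x = 0 → closedBall x 1 ⊆ D → g x = f x := by
  classical
  obtain ⟨g, hg, hgf⟩ := exists_extend_skel hW hf
  let w : (ι → ℝ) → ℝ := fun x => (1 - l x * T x)⁻¹
  have hlT (x) (hx : x ∈ B) : 0 < 1 - l x * T x := by
    have := hT01 x hx
    have := hl01 x hx
    nlinarith [this.1, this.2, (hT01 x hx).1, (hT01 x hx).2]
  have hw : ContinuousOn w B :=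
    (continuousOn_const.sub (hl.mul hT)).inv₀ fun x hx => (hlT x hx).ne'
  have hw1 (x) (hx : x ∈ B) : 1 ≤ w x := by
    refine (one_le_inv₀ (hlT x hx)).2 ?_
    have := mul_nonneg (hl01 x hx).1 (hT01 x hx).1
    linarith
  let R : (ι → ℝ) → ι → ℝ := fun x i => expandCell (w x) (x i)
  have hR : ContinuousOn R B := by
    rw [continuousOn_iff_continuous_domRestrict] at hw ⊢
    exact continuous_pi fun i => continuous_expandCell hw (fun x => hw1 x x.2)
      ((continuous_apply i).comp continuous_subtype_val)
  have hcell (x : ι → ℝ) : R x ∈ face (fun i => ⌊x i⌋) Finset.univ := by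
    refine ⟨fun i => ?_, fun i => ?_⟩ <;>
      have := expand_mem_Icc (w x) (Int.fract (x i)) <;> simp only [R, expandCell]
    · linarith [this.1]
    · simpa using this.2
  have hcore {x : ι → ℝ} (hx : closedBall x 1 ⊆ D) :
      face (fun i => ⌊x i⌋) Finset.univ ⊆ core D := by
    refine subset_iUnion_of_subset ⟨fun i => ⌊x i⌋, fun y hy => hx ?_⟩ subset_rfl
    rw [mem_closedBall, dist_pi_le_iff zero_le_one]
    intro i
    have h1 := hy.1 i
    have h2 := hy.2 i
    have h3 := Int.floor_le (x i)
    have h4 := Int.lt_floor_add_one (x i)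
    simp only [Finset.mem_univ, if_true] at h1 h2
    rw [Real.dist_eq, abs_le]
    constructor <;> linarith
  have hmaps : MapsTo R B (core D ∪ skel ι (p + 1)) := by
    intro x hx
    rcases hB x hx with h | ⟨h, hc⟩
    · exact Or.inl (hcore h (hcell x))
    · refine Or.inr (Nat.lt_succ_iff.2 ?_)
      have hsub : nonInt (R x) ⊆ (Finset.univ.filter fun i => intDist (x i) ≤ T x)ᶜ := by
        intro i hi
        rw [Finset.mem_compl, Finset.mem_filter]
        rintro ⟨-, hi'⟩
        obtain ⟨n, hn⟩ := exists_expandCell_eq_int (hT01 x hx).2 hi'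
        refine notMem_nonInt_of_eq (n := n) ?_ hi
        simpa only [R, w, h, one_mul] using hn
      have := Finset.card_le_card hsub
      rw [Finset.card_compl] at this
      omega
  refine ⟨g ∘ R, hg.comp hR hmaps, fun x hx h0 hD => ?_⟩
  have hRx : R x = x := by
    funext i
    simp only [R, w, h0, zero_mul, sub_zero, inv_one, expandCell]
    rw [expand_one ⟨Int.fract_nonneg _, (Int.fract_lt_one _).le⟩, Int.floor_add_fract]
  have := hgf (hcore hD (hcell x))
  rw [comp_apply]
  rwa [hRx] at this ⊢

theorem exists_pushforward_dual {W : Type*} [TopologicalSpace W] {p r : ℕ}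
    (hr : Fintype.card ι = p + r) (hW : ∀ J : Finset ι, J.card ≤ p → CubeExtends W J)
    {D B : Set (ι → ℝ)} {f : (ι → ℝ) → W} (hf : ContinuousOn f D) {T l : (ι → ℝ) → ℝ}
    (hT : ContinuousOn T B) (hl : ContinuousOn l B) (hT01 : ∀ x ∈ B, T x ∈ Ioc (0 : ℝ) 1)
    (hl01 : ∀ x ∈ B, l x ∈ Icc (0 : ℝ) 1)
    (hB : ∀ x ∈ B, closedBall x 1 ⊆ D ∨
      l x = 1 ∧ r ≤ (Finset.univ.filter fun i => T x ≤ intDist (x i)).card) :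
    ∃ g : (ι → ℝ) → W, ContinuousOn g B ∧
      ∀ x ∈ B, l x = 0 → closedBall x 1 ⊆ D → g x = f x := by
  let c : ι → ℝ := fun _ => 1 / 2
  let σ : (ι → ℝ) → ι → ℝ := fun x => x - c
  have hσ : Continuous σ := continuous_id.sub continuous_const
  have hball (x : ι → ℝ) : closedBall (σ x) 1 ⊆ D ↔ closedBall x 1 ⊆ σ ⁻¹' D := by
    refine ⟨fun h y hy => h ?_, fun h y hy => ?_⟩
    · rwa [mem_closedBall, dist_sub_right]
    · have : y + c ∈ closedBall x 1 := by
        rwa [mem_closedBall, ← dist_sub_right _ _ c, add_sub_cancel_right]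
      simpa [σ] using h this
  obtain ⟨g, hg, hgf⟩ := exists_pushforward hr hW (D := σ ⁻¹' D) (B := σ ⁻¹' B) (f := f ∘ σ)
    (T := fun x => 1 - T (σ x)) (l := l ∘ σ) (hf.comp hσ.continuousOn fun _ h => h)
    (continuousOn_const.sub (hT.comp hσ.continuousOn fun _ h => h))
    (hl.comp hσ.continuousOn fun _ h => h)
    (fun x hx => ⟨by linarith [(hT01 _ hx).2], by linarith [(hT01 _ hx).1]⟩)
    (fun x hx => hl01 _ hx) (fun x hx => by
      refine (hB _ hx).imp (hball x).1 (And.imp_right fun h => h.trans_eq ?_)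
      congr 1
      ext i
      simp only [Finset.mem_filter, Finset.mem_univ, true_and]
      have : intDist (x i) = 1 - intDist (σ x i) := by
        rw [← intDist_add_half]; simp [σ, c]
      rw [this]
      exact (sub_le_sub_iff_left 1).symm)
  have hc (x : ι → ℝ) : σ (x + c) = x := add_sub_cancel_right x c
  refine ⟨fun x => g (x + c), hg.comp (by fun_prop) fun x hx => ?_, fun x hx h0 hD => ?_⟩
  · rwa [mem_preimage, hc]
  · change g (x + c) = f x
    rw [hgf (x + c) (by rwa [mem_preimage, hc]) (by rwa [comp_apply, hc])
      ((hball _).1 (by rwa [hc])), comp_apply, hc]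

theorem exists_orderStatistic {p q : ℕ} (h : Fintype.card ι = p + q + 1) :
    ∃ o : (ι → ℝ) → ℝ, Continuous o ∧ ∀ d,
      q + 1 ≤ (Finset.univ.filter fun i => d i ≤ o d).card ∧
      p + 1 ≤ (Finset.univ.filter fun i => o d ≤ d i).card := by
  classical
  have hne : (Finset.powersetCard (q + 1) (Finset.univ : Finset ι)).attach.Nonempty :=
    Finset.attach_nonempty_iff.2
      (Finset.powersetCard_nonempty.2 (by rw [Finset.card_univ]; omega))
  have hS (S : {S // S ∈ Finset.powersetCard (q + 1) (Finset.univ : Finset ι)}) :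
      S.1.card = q + 1 := (Finset.mem_powersetCard.1 S.2).2
  have hS' (S : {S // S ∈ Finset.powersetCard (q + 1) (Finset.univ : Finset ι)}) :
      S.1.Nonempty := Finset.card_pos.1 (by rw [hS]; omega)
  refine ⟨fun d => Finset.inf' _ hne fun S => S.1.sup' (hS' S) d, ?_, fun d => ⟨?_, ?_⟩⟩
  · exact Continuous.finset_inf'_apply hne fun S _ =>
      Continuous.finset_sup'_apply (hS' S) fun i _ => continuous_apply i
  · obtain ⟨S, -, h⟩ := Finset.exists_mem_eq_inf' hne fun S => S.1.sup' (hS' S) d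
    dsimp only
    refine (hS S).symm.le.trans (Finset.card_le_card fun i hi => ?_)
    rw [Finset.mem_filter]
    exact ⟨Finset.mem_univ _, (Finset.le_sup' d hi).trans h.ge⟩
  · by_contra! hlt
    have hcompl := Finset.card_compl
      (Finset.univ.filter fun i => (Finset.inf' _ hne fun S => S.1.sup' (hS' S) d) ≤ d i)
    obtain ⟨S, hSsub, hScard⟩ := Finset.exists_subset_card_eq (n := q + 1)
      (s := (Finset.univ.filter fun i =>
        (Finset.inf' _ hne fun S => S.1.sup' (hS' S) d) ≤ d i)ᶜ) (by omega)
    have hSm : S ∈ Finset.powersetCard (q + 1) (Finset.univ : Finset ι) :=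
      Finset.mem_powersetCard.2 ⟨Finset.subset_univ _, hScard⟩
    have h1 := Finset.inf'_le (fun S => S.1.sup' (hS' S) d) (Finset.mem_attach _ ⟨S, hSm⟩)
    obtain ⟨i, hi, h2⟩ := Finset.exists_mem_eq_sup' (hS' ⟨S, hSm⟩) d
    have h3 := hSsub hi
    rw [Finset.mem_compl, Finset.mem_filter, not_and, ← h2] at h3
    exact h3 (Finset.mem_univ _) h1

end Retraction

section Main

variable {Y Z : Type*} [TopologicalSpace Y] [TopologicalSpace Z] {ι : Type*} [Fintype ι]

/-- A piecewise linear cutoff function: `0` for `t ≤ 0` and `1` for `1 ≤ t`. -/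
noncomputable def clamp (t : ℝ) : ℝ := max 0 (min 1 t)

theorem continuous_clamp : Continuous clamp := by unfold clamp; fun_prop

theorem clamp_mem_Icc (t : ℝ) : clamp t ∈ Icc (0 : ℝ) 1 :=
  ⟨le_max_left _ _, max_le zero_le_one (min_le_left _ _)⟩

theorem clamp_eq_zero {t : ℝ} (h : t ≤ 0) : clamp t = 0 :=
  max_eq_left ((min_le_right _ _).trans h)

theorem clamp_eq_one {t : ℝ} (h : 1 ≤ t) : clamp t = 1 := by
  rw [clamp, min_eq_left h, max_eq_right zero_le_one]

/-- Up to stretching, a map from the boundary of a cube to the join extends to the cube. -/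
theorem exists_extend_stretchMap [Nonempty Y] [Nonempty Z] {p q : ℕ}
    (hι : Fintype.card ι = p + q + 1)
    (hY : ∀ J : Finset ι, J.card ≤ p → CubeExtends Y J)
    (hZ : ∀ J : Finset ι, J.card ≤ q → CubeExtends Z J)
    {F : (ι → ℝ) → Quot (JoinRel Y Z)} (hF : ContinuousOn F {0}ᶜ) :
    ∃ (N : ℝ) (G : (ι → ℝ) → Quot (JoinRel Y Z)), 0 < N ∧ ContinuousOn G (closedBall 0 N) ∧
      ∀ x, ‖x‖ = N → G x = stretchMap (F (N⁻¹ • x)) 1 := by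
  obtain ⟨y₀⟩ := ‹Nonempty Y›
  obtain ⟨z₀⟩ := ‹Nonempty Z›
  have hcomp : IsCompact (closedBall (0 : ι → ℝ) 2 \ ball 0 (1 / 4)) :=
    (isCompact_closedBall _ _).diff isOpen_ball
  have hparam : ContinuousOn (fun u => param (F u)) {0}ᶜ :=
    continuous_param.comp_continuousOn hF
  have hunif := hcomp.uniformContinuousOn_of_continuous (hparam.mono (by
    rintro u ⟨-, hu⟩ rfl
    exact hu (mem_ball_self (by norm_num))))
  rw [Metric.uniformContinuousOn_iff] at hunif
  obtain ⟨δ, hδ, hunif⟩ := hunif (1 / 8) (by norm_num)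
  let N : ℝ := max 4 (2 / δ)
  have hN4 : 4 ≤ N := le_max_left _ _
  have hN0 : 0 < N := by linarith
  have hNδ : N⁻¹ < δ := by
    have h1 : 2 / δ ≤ N := le_max_right _ _
    rw [div_le_iff₀ hδ] at h1
    rw [inv_lt_iff_one_lt_mul₀ hN0]
    linarith
  have hnorm (x : ι → ℝ) : ‖N⁻¹ • x‖ = ‖x‖ / N := by
    rw [norm_smul, norm_inv, Real.norm_of_nonneg hN0.le, div_eq_inv_mul]
  let Fs : (ι → ℝ) → Quot (JoinRel Y Z) := fun x => F (N⁻¹ • x)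
  let τ : (ι → ℝ) → ℝ := fun x => param (Fs x)
  have hsmul : MapsTo (fun x : ι → ℝ => N⁻¹ • x) {0}ᶜ {0}ᶜ := by
    intro x hx
    simpa [hN0.ne'] using hx
  have hFs : ContinuousOn Fs {0}ᶜ := hF.comp (by fun_prop) hsmul
  have hτ : ContinuousOn τ {0}ᶜ := continuous_param.comp_continuousOn hFs
  have hτ01 (x) : τ x ∈ Icc (0 : ℝ) 1 := param_mem_Icc _
  have hclose {x x' : ι → ℝ} (hx1 : N / 2 ≤ ‖x‖) (hx2 : ‖x‖ ≤ N) (hxx' : x' ∈ closedBall x 1) :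
      x' ≠ 0 ∧ |τ x' - τ x| < 1 / 8 := by
    rw [mem_closedBall, dist_eq_norm] at hxx'
    have h1 : ‖x'‖ ≤ ‖x‖ + 1 := by linarith [norm_sub_norm_le x' x]
    have h2 : ‖x‖ - 1 ≤ ‖x'‖ := by linarith [norm_sub_norm_le x x', norm_sub_rev x x']
    refine ⟨norm_pos_iff.1 (by linarith), ?_⟩
    rw [← Real.dist_eq]
    refine hunif _ ⟨?_, ?_⟩ _ ⟨?_, ?_⟩ ?_
    · rw [mem_closedBall_zero_iff, hnorm, div_le_iff₀ hN0]; linarith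
    · rw [mem_ball_zero_iff, hnorm, not_lt, le_div_iff₀ hN0]; linarith
    · rw [mem_closedBall_zero_iff, hnorm, div_le_iff₀ hN0]; linarith
    · rw [mem_ball_zero_iff, hnorm, not_lt, le_div_iff₀ hN0]; linarith
    · rw [dist_eq_norm, ← smul_sub, hnorm]
      refine lt_of_le_of_lt ?_ hNδ
      rw [div_eq_mul_inv]
      exact mul_le_of_le_one_left (inv_nonneg.2 hN0.le) hxx'
  obtain ⟨o, ho, hoc⟩ := exists_orderStatistic hι
  let θ : (ι → ℝ) → ℝ := fun x => o fun i => intDist (x i)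
  have hθ : Continuous θ :=
    ho.comp (continuous_pi fun i => continuous_intDist.comp (continuous_apply i))
  have hθ01 (x) : θ x ∈ Icc (0 : ℝ) 1 := by
    obtain ⟨h1, h2⟩ := hoc fun i => intDist (x i)
    obtain ⟨i, hi⟩ := Finset.card_pos.1 (Nat.succ_pos _ |>.trans_le h1)
    obtain ⟨j, hj⟩ := Finset.card_pos.1 (Nat.succ_pos _ |>.trans_le h2)
    exact ⟨(intDist_mem_Icc _).1.trans (Finset.mem_filter.1 hi).2,
      (Finset.mem_filter.1 hj).2.trans (intDist_mem_Icc _).2⟩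
  let l : (ι → ℝ) → ℝ := fun x => clamp (4 * (1 - ‖x‖ / N))
  let ν : (ι → ℝ) → ℝ := fun x => clamp (3 - 4 * (‖x‖ / N))
  have hl : Continuous l := continuous_clamp.comp (by fun_prop)
  have hν : Continuous ν := continuous_clamp.comp (by fun_prop)
  have hl01 (x) : l x ∈ Icc (0 : ℝ) 1 := clamp_mem_Icc _
  have hν01 (x) : ν x ∈ Icc (0 : ℝ) 1 := clamp_mem_Icc _
  have hlν (x) : l x = 1 ∨ ν x = 0 ∧ N / 2 ≤ ‖x‖ := by
    by_cases h : ‖x‖ / N ≤ 3 / 4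
    · exact Or.inl (clamp_eq_one (by linarith))
    · refine Or.inr ⟨clamp_eq_zero (by linarith), ?_⟩
      rw [not_le, lt_div_iff₀ hN0] at h
      linarith
  have hνN {x} (h : ν x ≠ 1) : N / 2 ≤ ‖x‖ := by
    by_contra! hx
    refine h (clamp_eq_one ?_)
    have : ‖x‖ / N ≤ 1 / 2 := by rw [div_le_iff₀ hN0]; linarith
    linarith
  let T : (ι → ℝ) → ℝ := fun x => (1 - ν x) * τ x + ν x * θ x
  have hT : Continuous T := by
    rw [continuous_iff_continuousAt]
    intro x
    by_cases hx : x = 0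
    · have : T =ᶠ[𝓝 x] θ := by
        have : ∀ᶠ x' in 𝓝 x, ‖x'‖ < N / 2 :=
          continuous_norm.continuousAt.eventually_lt_const (by simpa [hx] using hN0)
        filter_upwards [this] with x' hx'
        have : ν x' = 1 := by
          by_contra h
          exact absurd (hνN h) (not_le.2 hx')
        simp only [T, this]; ring
      exact hθ.continuousAt.congr this.symm
    · have := hτ.continuousAt (isOpen_compl_singleton.mem_nhds hx)
      exact ((continuousAt_const.sub hν.continuousAt).mul this).add
        (hν.continuousAt.mul hθ.continuousAt)
  have hT01 (x) : T x ∈ Icc (0 : ℝ) 1 := by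
    have := (convex_Icc (0 : ℝ) 1) (hτ01 x) (hθ01 x) (sub_nonneg.2 (hν01 x).2) (hν01 x).1
      (sub_add_cancel _ _)
    simpa [T] using this
  obtain ⟨y, hy, hyb⟩ := exists_pushforward (r := q + 1) (by omega) hY
    (D := {x | x ≠ 0 ∧ τ x < 1}) (B := closedBall 0 N ∩ {x | T x < 3 / 4})
    (f := fun x => fstPt y₀ (Fs x)) (T := T) (l := l)
    ((continuousOn_fstPt y₀).comp (hFs.mono fun x hx => hx.1) fun x hx => hx.2)
    hT.continuousOn hl.continuousOn (fun x hx => ⟨(hT01 x).1, hx.2.trans (by norm_num)⟩)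
    (fun x _ => hl01 x) (by
      rintro x ⟨hxN, hx⟩
      rw [mem_closedBall_zero_iff] at hxN
      by_cases hcase : l x = 1 ∧ θ x ≤ T x
      · refine Or.inr ⟨hcase.1, (hoc fun i => intDist (x i)).1.trans (Finset.card_le_card ?_)⟩
        exact Finset.monotone_filter_right _ fun i _ hi => hi.trans hcase.2
      · have key : N / 2 ≤ ‖x‖ ∧ τ x < 3 / 4 := by
          rcases hlν x with h | ⟨h, h'⟩
          · have h1 : T x < θ x := by
              rw [not_and] at hcase; exact not_le.1 (hcase h)
            refine ⟨hνN fun h2 => ?_, ?_⟩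
            · simp [T, h2] at h1
            · by_contra! h2
              have h3 : T x < 3 / 4 := hx
              simp only [T] at h1 h3
              have h4 : τ x < θ x := by
                by_contra! h5
                have := mul_nonneg (sub_nonneg.2 (hν01 x).2) (sub_nonneg.2 h5)
                linarith
              have := mul_nonneg (hν01 x).1 (sub_nonneg.2 h4.le)
              linarith
          · refine ⟨h', ?_⟩
            simpa [T, h] using hx
        refine Or.inl fun x' hx' => ?_
        obtain ⟨h1, h2⟩ := hclose key.1 hxN hx'
        exact ⟨h1, by linarith [(abs_lt.1 h2).2, key.2]⟩)
  obtain ⟨z, hz, hzb⟩ := exists_pushforward_dual (r := p + 1) (by omega) hZ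
    (D := {x | x ≠ 0 ∧ 0 < τ x}) (B := closedBall 0 N ∩ {x | 1 / 4 < T x})
    (f := fun x => sndPt z₀ (Fs x)) (T := T) (l := l)
    ((continuousOn_sndPt z₀).comp (hFs.mono fun x hx => hx.1) fun x hx => hx.2)
    hT.continuousOn hl.continuousOn
    (fun x hx => ⟨(by norm_num : (0 : ℝ) < 1 / 4).trans hx.2, (hT01 x).2⟩)
    (fun x _ => hl01 x) (by
      rintro x ⟨hxN, hx⟩
      rw [mem_closedBall_zero_iff] at hxN
      by_cases hcase : l x = 1 ∧ T x ≤ θ x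
      · refine Or.inr ⟨hcase.1, (hoc fun i => intDist (x i)).2.trans (Finset.card_le_card ?_)⟩
        exact Finset.monotone_filter_right _ fun i _ hi => hcase.2.trans hi
      · have key : N / 2 ≤ ‖x‖ ∧ 1 / 4 < τ x := by
          rcases hlν x with h | ⟨h, h'⟩
          · have h1 : θ x < T x := by
              rw [not_and] at hcase; exact not_le.1 (hcase h)
            refine ⟨hνN fun h2 => ?_, ?_⟩
            · simp [T, h2] at h1
            · by_contra! h2
              have h3 : 1 / 4 < T x := hx
              simp only [T] at h1 h3
              have h4 : θ x < τ x := by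
                by_contra! h5
                have := mul_nonneg (sub_nonneg.2 (hν01 x).2) (sub_nonneg.2 h5)
                linarith
              have := mul_nonneg (hν01 x).1 (sub_nonneg.2 h4.le)
              linarith
          · refine ⟨h', ?_⟩
            simpa [T, h] using hx
        refine Or.inl fun x' hx' => ?_
        obtain ⟨h1, h2⟩ := hclose key.1 hxN hx'
        exact ⟨h1, by linarith [(abs_lt.1 h2).1, key.2]⟩)
  refine ⟨N, _, hN0, continuousOn_mk_stretch hT.continuousOn hy hz, fun x hx => ?_⟩
  have hxN : x ∈ closedBall 0 N := by rw [mem_closedBall_zero_iff, hx]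
  have hx1 : ‖x‖ / N = 1 := by rw [hx, div_self hN0.ne']
  have hl0 : l x = 0 := clamp_eq_zero (by rw [hx1]; norm_num)
  have hTx : T x = τ x := by
    have : ν x = 0 := clamp_eq_zero (by rw [hx1]; norm_num)
    simp [T, this]
  have hclose' {x' : ι → ℝ} := hclose (x' := x') (by linarith : N / 2 ≤ ‖x‖) hx.le
  rw [hTx]
  refine (stretchMap_one_eq_mk (y₀ := y₀) (z₀ := z₀) (fun h => ?_) fun h => ?_).symm
  · refine hyb x ⟨hxN, hTx.trans_lt h⟩ hl0 fun x' hx' => ?_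
    have h' : τ x < 3 / 4 := h
    exact ⟨(hclose' hx').1, by linarith [(abs_lt.1 (hclose' hx').2).2]⟩
  · refine hzb x ⟨hxN, h.trans_eq hTx.symm⟩ hl0 fun x' hx' => ?_
    have h' : 1 / 4 < τ x := h
    exact ⟨(hclose' hx').1, by linarith [(abs_lt.1 (hclose' hx').2).1]⟩

theorem cubeExtends_join [Nonempty Y] [Nonempty Z] {p q : ℕ} (hι : Fintype.card ι = p + q + 1)
    (hY : ∀ J : Finset ι, J.card ≤ p → CubeExtends Y J)
    (hZ : ∀ J : Finset ι, J.card ≤ q → CubeExtends Z J) :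
    CubeExtends (Quot (JoinRel Y Z)) ι := by
  classical
  intro f hf
  let F : (ι → ℝ) → Quot (JoinRel Y Z) := fun u => f (‖u‖⁻¹ • u)
  have hF : ContinuousOn F {0}ᶜ := by
    refine hf.comp ((continuous_norm.continuousOn.inv₀ fun u hu => norm_ne_zero_iff.2 hu).smul
      continuousOn_id) fun u hu => ?_
    rw [mem_sphere_zero_iff_norm, norm_smul, norm_inv, norm_norm,
      inv_mul_cancel₀ (norm_ne_zero_iff.2 hu)]
  have hFr {c : ℝ} (hc : 0 < c) (u : ι → ℝ) : F (c • u) = F u := by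
    simp only [F]
    rw [norm_smul, Real.norm_of_nonneg hc.le, smul_smul]
    congr 2
    field_simp
  obtain ⟨N, G, hN, hG, hGF⟩ := exists_extend_stretchMap hι hY hZ hF
  let g : (ι → ℝ) → Quot (JoinRel Y Z) := fun u =>
    if ‖u‖ ≤ 1 / 2 then G ((2 * N) • u)
    else stretchMap (F u) (projIcc 0 1 zero_le_one (2 - 2 * ‖u‖))
  have hg1 : ContinuousOn g (closedBall 0 (1 / 2)) := by
    refine (hG.comp (g := G) (f := fun u : ι → ℝ => (2 * N) • u) (by fun_prop)
      (s := closedBall 0 (1 / 2)) fun u hu => ?_).congr fun u hu => ?_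
    · rw [mem_closedBall_zero_iff] at hu ⊢
      rw [norm_smul, Real.norm_of_nonneg (by positivity)]
      nlinarith
    · rw [mem_closedBall_zero_iff] at hu
      exact if_pos hu
  have hg2 : ContinuousOn g {u | 1 / 2 ≤ ‖u‖} := by
    have hpair : ContinuousOn (fun u : ι → ℝ =>
        (F u, projIcc (0 : ℝ) 1 zero_le_one (2 - 2 * ‖u‖))) {u | 1 / 2 ≤ ‖u‖} := by
      refine (hF.mono fun u hu => ?_).prodMk
        (continuous_projIcc.comp (by fun_prop)).continuousOn
      have hu' : 1 / 2 ≤ ‖u‖ := hu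
      exact norm_pos_iff.1 (by linarith)
    refine (continuous_stretchMap.comp_continuousOn hpair).congr fun u hu => ?_
    have hu' : 1 / 2 ≤ ‖u‖ := hu
    by_cases h : ‖u‖ ≤ 1 / 2
    · have heq : ‖u‖ = 1 / 2 := le_antisymm h hu'
      have hnorm : ‖(2 * N) • u‖ = N := by
        rw [norm_smul, Real.norm_of_nonneg (by positivity), heq]; ring
      simp only [g, if_pos h, comp_apply]
      rw [hGF _ hnorm, hFr (inv_pos.2 hN), hFr (by positivity),
        projIcc_of_right_le _ (by linarith)]
      rfl
    · simp only [g, if_neg h, comp_apply]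
  refine ⟨g, (hg1.union_of_isClosed hg2 isClosed_closedBall
    (isClosed_le continuous_const continuous_norm)).mono fun u _ => ?_, fun u hu => ?_⟩
  · rw [mem_union, mem_closedBall_zero_iff]
    exact le_total _ _
  · rw [mem_sphere_zero_iff_norm] at hu
    have h : ¬ ‖u‖ ≤ 1 / 2 := by rw [hu]; norm_num
    simp only [g, if_neg h]
    rw [projIcc_of_le_left _ (by rw [hu]; norm_num)]
    refine (stretchMap_zero _).trans ?_
    simp [F, hu]

end Main

end JoinConnectivity

/-- if `Y` is `m`-connected and `Z` is `n`-connected, then the join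
`Y ∗ Z` is `(m + n + 2)`-connected.  (In terms of `IsConnGE`, being `m`-connected is
`IsConnGE · (m+1)`.) -/
theorem stmt5 (Y Z : Type*) [TopologicalSpace Y] [TopologicalSpace Z] (m n : ℕ)
    (hY : IsConnGE Y (m + 1)) (hZ : IsConnGE Z (n + 1)) :
    IsConnGE (Quot (JoinRel Y Z)) (m + n + 3) := by
  have hY₀ := JoinConnectivity.IsConnGE.nonempty hY
  have hZ₀ := JoinConnectivity.IsConnGE.nonempty hZ
  have : Nonempty (Quot (JoinRel Y Z)) := hY₀.elim fun y => hZ₀.elim fun z => ⟨Quot.mk _ (y, z, 0)⟩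
  refine JoinConnectivity.isConnGE_of_cubeExtends fun k hk => ?_
  rcases Nat.eq_zero_or_pos k with rfl | hk0
  · intro f _
    refine ⟨f, fun x _ => ?_, fun _ _ => rfl⟩
    exact (continuous_of_discreteTopology (f := f)).continuousWithinAt
  · refine JoinConnectivity.cubeExtends_join (p := min (k - 1) (m + 1))
      (q := k - 1 - min (k - 1) (m + 1)) (by rw [Fintype.card_fin]; omega)
      (fun J hJ => ?_) fun J hJ => ?_
    · exact JoinConnectivity.IsConnGE.cubeExtends hY (by rw [Fintype.card_coe]; omega)
    · exact JoinConnectivity.IsConnGE.cubeExtends hZ (by rw [Fintype.card_coe]; omega)
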